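/- (Proposition 2.3, inner-product form) Let μ be a partition, ν a partition, and k an integer with k ≥ ν_1, so that (k,ν_1,ν_2,…) is a partition. Fix N ≥ |μ| and N ≥ ℓ(ν)+1. Then ⟨q_μ(x;t), s_{(k,ν)}⟩ = ∑_{τ ∈ C_μ, |τ| ≥ k} (1−t)^{ℓ(τ)} · (−1)^{|τ|−k} · ⟨q_{μ−τ}(x;t) · e_{|τ|−k}(x), s_ν⟩, where the sum runs over all sequences τ = (τ_1,…,τ_{ℓ(μ)}) of nonnegative integers with τ_i ≤ μ_i for all i and τ_1+⋯+τ_{ℓ(μ)} ≥ k; here |τ| = ∑_i τ_i, ℓ(τ) is the number of nonzero τ_i, e_0 = 1, and q_{μ−τ}(x;t) = ∏_{i : μ_i−τ_i > 0} q_{μ_i−τ_i}(x;t). -/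

import Mathlib

/-!
STATEMENT 6 (Proposition 2.3, inner-product form): for partitions μ, ν, and
k ≥ ν_1, with N ≥ |μ| and N ≥ ℓ(ν)+1,
⟨q_μ(x;t), s_{(k,ν)}⟩
  = ∑_{τ ∈ C_μ, |τ| ≥ k} (1−t)^{ℓ(τ)} (−1)^{|τ|−k} ⟨q_{μ−τ}(x;t)·e_{|τ|−k}(x), s_ν⟩.
-/

noncomputable section
open MvPolynomial

/-- The field ℚ(t) of rational functions. -/
abbrev K : Type := RatFunc ℚ

/-- z_λ = ∏_i i^{m_i(λ)} · m_i(λ)! , as a rational number. -/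
def zCoeff {n : ℕ} (lam : Nat.Partition n) : ℚ :=
  (lam.parts.map fun i => (i : ℚ)).prod *
    ∏ i ∈ lam.parts.toFinset, (Nat.factorial (lam.parts.count i) : ℚ)

/-- z_λ(t) = z_λ / ∏_j (1 − t^{λ_j}). -/
def zCoeffT {n : ℕ} (t : K) (lam : Nat.Partition n) : K :=
  ((zCoeff lam : ℚ) : K) / (lam.parts.map fun j => 1 - t ^ j).prod

/-- The power-sum product p_λ = p_{λ_1} p_{λ_2} ⋯ in N variables. -/
def pPoly (N : ℕ) {n : ℕ} (lam : Nat.Partition n) : MvPolynomial (Fin N) K :=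
  (lam.parts.map fun r => psum (Fin N) K r).prod

/-- The one-row Hall–Littlewood function q_r(x;t) = ∑_{λ⊢r} p_λ / z_λ(t). -/
def qone (N : ℕ) (t : K) (r : ℕ) : MvPolynomial (Fin N) K :=
  ∑ lam : Nat.Partition r, C (zCoeffT t lam)⁻¹ * pPoly N lam

/-- q of a multiset of positive integers: the product of one-row functions. -/
def qMulti (N : ℕ) (t : K) (s : Multiset ℕ) : MvPolynomial (Fin N) K :=
  (s.map (qone N t)).prod

/-- The parts of a multiset, sorted in decreasing order. -/
def descSort (s : Multiset ℕ) : List ℕ := (s.sort (· ≤ ·)).reverse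

/-- Vandermonde product ∏_{i<j} (x_i − x_j). -/
def vandermonde (N : ℕ) : MvPolynomial (Fin N) K :=
  ∏ p ∈ Finset.univ.filter (fun p : Fin N × Fin N => p.1 < p.2), (X p.1 - X p.2)

/-- Hall pairing ⟨f, s_λ⟩: the coefficient of x_1^{λ_1+N-1}⋯x_N^{λ_N} in
f · ∏_{i<j}(x_i − x_j), where λ is given as a function `Fin N → ℕ`. -/
def hallPair (N : ℕ) (f : MvPolynomial (Fin N) K) (lamF : Fin N → ℕ) : K :=
  MvPolynomial.coeff
    (Finsupp.equivFunOnFinite.symm fun i : Fin N => lamF i + (N - 1 - (i : ℕ)))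
    (f * vandermonde N)

section PowerSumExp

variable {A : Type*} [CommRing A] [Algebra K A]

/-- The coefficient of `u ^ r` in `exp (∑ j, a j * u ^ j / j)`, as a sum over partitions of `r`. -/
def powerSumExp (a : ℕ → A) (r : ℕ) : A :=
  ∑ lam : Nat.Partition r, algebraMap K A ((zCoeff lam : ℚ) : K)⁻¹ * (lam.parts.map a).prod

theorem map_powerSumExp {B : Type*} [CommRing B] [Algebra K B] (φ : A →ₐ[K] B) (a : ℕ → A)
    (r : ℕ) : φ (powerSumExp a r) = powerSumExp (fun j => φ (a j)) r := by
  simp [powerSumExp, map_sum, map_multiset_prod, Multiset.map_map]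

theorem powerSumExp_zero (a : ℕ → A) : powerSumExp a 0 = 1 := by
  simp [powerSumExp, zCoeff]

theorem prod_factorial_count_cons (a : ℕ) (s : Multiset ℕ) :
    ∏ i ∈ (a ::ₘ s).toFinset, (Nat.factorial ((a ::ₘ s).count i) : ℚ) =
      (s.count a + 1) * ∏ i ∈ s.toFinset, (Nat.factorial (s.count i) : ℚ) := by
  have hs : s.toFinset ⊆ insert a s.toFinset := Finset.subset_insert _ _
  rw [Finset.prod_subset hs (f := fun i => (Nat.factorial (s.count i) : ℚ))
    (fun i _ hi => by simp [Multiset.count_eq_zero.2 (fun h => hi (Multiset.mem_toFinset.2 h))]),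
    Multiset.toFinset_cons, ← Finset.mul_prod_erase _ _ (Finset.mem_insert_self a _),
    ← Finset.mul_prod_erase (insert a s.toFinset) _ (Finset.mem_insert_self a _), ← mul_assoc]
  congr 1
  · rw [Multiset.count_cons_self, Nat.factorial_succ]
    push_cast
    ring
  · refine Finset.prod_congr rfl fun i hi => ?_
    rw [Multiset.count_cons_of_ne (Finset.ne_of_mem_erase hi)]

theorem zCoeff_eq {n : ℕ} (lam : Nat.Partition n) :
    zCoeff lam = (lam.parts.map (Nat.cast : ℕ → ℚ)).prod *
      ∏ i ∈ lam.parts.toFinset, (Nat.factorial (lam.parts.count i) : ℚ) := by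
  simp [zCoeff, Multiset.bind_def, Multiset.pure_def, Multiset.bind_singleton]

theorem zCoeff_of_parts_eq_cons {m n j : ℕ} {lam : Nat.Partition m} {lam' : Nat.Partition n}
    (h : lam'.parts = j ::ₘ lam.parts) :
    zCoeff lam' = j * (lam.parts.count j + 1) * zCoeff lam := by
  rw [zCoeff_eq, zCoeff_eq, h, prod_factorial_count_cons, Multiset.map_cons, Multiset.prod_cons]
  ring

theorem zCoeff_ne_zero {n : ℕ} (lam : Nat.Partition n) : zCoeff lam ≠ 0 := by
  rw [zCoeff_eq]
  refine mul_ne_zero (Multiset.prod_ne_zero ?_) ?_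
  · simp only [Multiset.mem_map, Nat.cast_eq_zero, exists_eq_right]
    exact fun h => lt_irrefl _ (lam.parts_pos h)
  · exact Finset.prod_ne_zero_iff.2 fun i _ => by exact_mod_cast Nat.factorial_ne_zero _

/-- Adding a part `j` to a partition of `i`. -/
def consPart (i : ℕ) {j : ℕ} (hj : 0 < j) (lam : Nat.Partition i) : Nat.Partition (j + i) where
  parts := j ::ₘ lam.parts
  parts_pos := fun h => by
    rcases Multiset.mem_cons.1 h with rfl | h
    exacts [hj, lam.parts_pos h]
  parts_sum := by rw [Multiset.sum_cons, lam.parts_sum]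

theorem sum_mul_count_eq_mul_powerSumExp (a : ℕ → A) (i : ℕ) {j : ℕ} (hj : 0 < j) :
    ∑ lam : Nat.Partition (j + i), ((lam.parts.count j * j : ℕ) : A) *
      (algebraMap K A ((zCoeff lam : ℚ) : K)⁻¹ * (lam.parts.map a).prod) =
      a j * powerSumExp a i := by
  rw [powerSumExp, Finset.mul_sum]
  symm
  refine Finset.sum_of_injOn (consPart i hj) ?_ (by simp) ?_ ?_
  · intro l _ l' _ h
    have := congrArg Nat.Partition.parts h
    exact Nat.Partition.ext ((Multiset.cons_inj_right j).1 this)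
  · intro l _ hl
    have : j ∉ l.parts := by
      intro h
      refine hl ⟨⟨l.parts.erase j, fun h => l.parts_pos (Multiset.mem_of_mem_erase h), ?_⟩,
        by simp, Nat.Partition.ext (Multiset.cons_erase h)⟩
      have := congrArg Multiset.sum (Multiset.cons_erase h)
      rw [Multiset.sum_cons, l.parts_sum] at this
      omega
    simp [Multiset.count_eq_zero.2 this]
  · intro l _
    have hz : zCoeff (consPart i hj l) = j * (l.parts.count j + 1) * zCoeff l :=
      zCoeff_of_parts_eq_cons rfl
    have hp : (consPart i hj l).parts = j ::ₘ l.parts := rfl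
    have hl : ((zCoeff l : ℚ) : K) ≠ 0 := by exact_mod_cast zCoeff_ne_zero l
    have hj' : (j : K) ≠ 0 := by exact_mod_cast hj.ne'
    have hc : ((l.parts.count j : K) + 1) ≠ 0 := Nat.cast_add_one_ne_zero _
    have key : ((zCoeff l : ℚ) : K)⁻¹ =
        (((l.parts.count j + 1) * j : ℕ) : K) * ((zCoeff (consPart i hj l) : ℚ) : K)⁻¹ := by
      rw [hz]
      push_cast
      field_simp
    rw [key, hp, Multiset.count_cons_self, Multiset.map_cons, Multiset.prod_cons, map_mul,
      map_natCast]
    ring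

theorem natCast_mul_powerSumExp (a : ℕ → A) (ha : a 0 = 0) (n : ℕ) :
    (n : A) * powerSumExp a n =
      ∑ p ∈ Finset.HasAntidiagonal.antidiagonal n, a p.1 * powerSumExp a p.2 := by
  have h1 : (n : A) * powerSumExp a n = ∑ lam : Nat.Partition n,
      ∑ p ∈ Finset.HasAntidiagonal.antidiagonal n, ((lam.parts.count p.1 * p.1 : ℕ) : A) *
      (algebraMap K A ((zCoeff lam : ℚ) : K)⁻¹ * (lam.parts.map a).prod) := by
    rw [powerSumExp, Finset.mul_sum]
    refine Finset.sum_congr rfl fun lam _ => ?_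
    rw [← Finset.sum_mul, ← Nat.cast_sum]
    congr 2
    rw [Finset.Nat.sum_antidiagonal_eq_sum_range_succ_mk]
    have hs : lam.parts.toFinset ⊆ Finset.range (n + 1) := fun i hi => by
      rw [Finset.mem_range, Nat.lt_succ_iff]
      exact (Multiset.le_sum_of_mem (Multiset.mem_toFinset.1 hi)).trans lam.parts_sum.le
    conv_lhs => rw [← lam.parts_sum, Finset.sum_multiset_count_of_subset _ _ hs]
    simp
  rw [h1, Finset.sum_comm]
  refine Finset.sum_congr rfl fun p hp => ?_
  obtain ⟨j, i⟩ := p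
  rw [Finset.HasAntidiagonal.mem_antidiagonal] at hp
  subst hp
  rcases Nat.eq_zero_or_pos j with rfl | hj
  · simp [ha]
  · exact sum_mul_count_eq_mul_powerSumExp a i hj

theorem eq_powerSumExp (a F : ℕ → A) (ha : a 0 = 0) (h0 : F 0 = 1)
    (hF : ∀ n : ℕ, (n : A) * F n = ∑ p ∈ Finset.HasAntidiagonal.antidiagonal n, a p.1 * F p.2) (n : ℕ) :
    F n = powerSumExp a n := by
  induction n using Nat.strong_induction_on with
  | _ n ih =>
    rcases Nat.eq_zero_or_pos n with rfl | hn
    · rw [h0, powerSumExp_zero]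
    · have hu : IsUnit (n : A) := by
        have : IsUnit (n : K) := IsUnit.mk0 _ (by exact_mod_cast hn.ne')
        simpa using this.map (algebraMap K A)
      refine hu.mul_left_cancel ?_
      rw [hF, natCast_mul_powerSumExp a ha]
      refine Finset.sum_congr rfl fun p hp => ?_
      obtain ⟨j, i⟩ := p
      rw [Finset.HasAntidiagonal.mem_antidiagonal] at hp
      rcases Nat.eq_zero_or_pos j with rfl | hj
      · simp [ha]
      · rw [ih i (by lia)]

theorem powerSumExp_add (a b : ℕ → A) (ha : a 0 = 0) (hb : b 0 = 0) (n : ℕ) :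
    powerSumExp (fun j => a j + b j) n =
      ∑ p ∈ Finset.HasAntidiagonal.antidiagonal n, powerSumExp a p.1 * powerSumExp b p.2 := by
  have hcoeff (F : PowerSeries A) (n : ℕ) :
      PowerSeries.coeff n (PowerSeries.X * PowerSeries.derivative A F) =
        (n : A) * PowerSeries.coeff n F := by
    cases n with
    | zero => simp
    | succ n =>
      rw [PowerSeries.coeff_succ_X_mul, PowerSeries.coeff_derivative]
      push_cast
      ring
  have hD (c : ℕ → A) (hc : c 0 = 0) :
      PowerSeries.X * PowerSeries.derivative A (PowerSeries.mk (powerSumExp c)) =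
        PowerSeries.mk c * PowerSeries.mk (powerSumExp c) := by
    ext n
    rw [hcoeff, PowerSeries.coeff_mul]
    simpa using natCast_mul_powerSumExp c hc n
  have hc (n : ℕ) : PowerSeries.coeff n
      (PowerSeries.mk (powerSumExp a) * PowerSeries.mk (powerSumExp b)) =
        ∑ p ∈ Finset.HasAntidiagonal.antidiagonal n, powerSumExp a p.1 * powerSumExp b p.2 := by
    simp [PowerSeries.coeff_mul]
  rw [← hc]
  symm
  refine eq_powerSumExp (fun j => a j + b j) (fun n => PowerSeries.coeff n
      (PowerSeries.mk (powerSumExp a) * PowerSeries.mk (powerSumExp b))) (by simp [ha, hb])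
      (by simp [powerSumExp_zero]) (fun n => ?_) n
  have hab : PowerSeries.X * PowerSeries.derivative A
      (PowerSeries.mk (powerSumExp a) * PowerSeries.mk (powerSumExp b)) =
      PowerSeries.mk (fun j => a j + b j) *
        (PowerSeries.mk (powerSumExp a) * PowerSeries.mk (powerSumExp b)) := by
    have hs : PowerSeries.mk (fun j => a j + b j) = PowerSeries.mk a + PowerSeries.mk b := by
      ext; simp
    rw [hs, Derivation.leibniz, smul_eq_mul, smul_eq_mul]
    linear_combination (PowerSeries.mk (powerSumExp b)) * hD a ha +
      (PowerSeries.mk (powerSumExp a)) * hD b hb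
  rw [← hcoeff, hab, PowerSeries.coeff_mul]
  simp

theorem powerSumExp_one_sub_pow_mul_pow (t x : A) (n : ℕ) :
    powerSumExp (fun j => (1 - t ^ j) * x ^ j) n =
      (if n = 0 then 1 else 1 - t) * x ^ n := by
  symm
  refine eq_powerSumExp _ (fun n => (if n = 0 then 1 else 1 - t) * x ^ n) (by simp) (by simp)
    (fun n => ?_) n
  rw [Finset.Nat.sum_antidiagonal_eq_sum_range_succ_mk, Finset.sum_range_succ]
  have h : ∑ k ∈ Finset.range n, (1 - t ^ k) * x ^ k *
      ((if n - k = 0 then 1 else 1 - t) * x ^ (n - k)) =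
      ((n : A) * (1 - t) - (1 - t ^ n)) * x ^ n := by
    rw [← mul_neg_geom_sum t n]
    have : ∀ k ∈ Finset.range n, (1 - t ^ k) * x ^ k *
      ((if n - k = 0 then 1 else 1 - t) * x ^ (n - k)) = (1 - t) * x ^ n * (1 - t ^ k) := by
      intro k hk
      have hk := Finset.mem_range.1 hk
      rw [if_neg (by omega), ← pow_mul_pow_sub x hk.le]
      ring
    rw [Finset.sum_congr rfl this, ← Finset.mul_sum, Finset.sum_sub_distrib]
    simp
    ring
  simp only [h]
  rcases Nat.eq_zero_or_pos n with rfl | hn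
  · simp
  · simp only [hn.ne', if_false, Nat.sub_self, if_true]
    ring

end PowerSumExp

section HallPairing

theorem qone_eq_powerSumExp (N : ℕ) (t : K) (r : ℕ) :
    qone N t r = powerSumExp (fun j => C (1 - t ^ j) * psum (Fin N) K j) r := by
  refine Finset.sum_congr rfl fun lam _ => ?_
  rw [Multiset.prod_map_mul, pPoly, zCoeffT, inv_div, div_eq_inv_mul, C_mul, mul_assoc,
    map_multiset_prod, Multiset.map_map]
  rfl

theorem qone_zero (N : ℕ) (t : K) : qone N t 0 = 1 := by
  rw [qone_eq_powerSumExp, powerSumExp_zero]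

theorem finSuccEquiv_qone (M : ℕ) (t : K) (r : ℕ) :
    finSuccEquiv K M (qone (M + 1) t r) = ∑ s : Fin (r + 1),
      Polynomial.C (C (if (s : ℕ) = 0 then 1 else 1 - t) * qone M t (r - s)) *
        Polynomial.X ^ (s : ℕ) := by
  have h : ∀ j : ℕ, finSuccEquiv K M (C (1 - t ^ j) * psum (Fin (M + 1)) K j) =
      (1 - (Polynomial.C (C t)) ^ j) * Polynomial.X ^ j +
        Polynomial.CAlgHom (R := K) (C (1 - t ^ j) * psum (Fin M) K j) := by
    intro j
    simp only [psum, Fin.sum_univ_succ, map_mul, map_add, map_sum, map_pow, map_sub, map_one,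
      finSuccEquiv_apply, eval₂Hom_C, Polynomial.CAlgHom_apply, RingHom.comp_apply]
    simp
    ring
  rw [qone_eq_powerSumExp]
  obtain ⟨φ, hφ⟩ : ∃ φ : MvPolynomial (Fin (M + 1)) K →ₐ[K] Polynomial (MvPolynomial (Fin M) K),
      ∀ p, φ p = finSuccEquiv K M p := ⟨(finSuccEquiv K M).toAlgHom, fun _ => rfl⟩
  have h1 := map_powerSumExp φ (fun j => C (1 - t ^ j) * psum (Fin (M + 1)) K j) r
  have h2 := fun n => map_powerSumExp (Polynomial.CAlgHom (R := K))
    (fun j => C (1 - t ^ j) * psum (Fin M) K j) n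
  simp only [hφ, h] at h1
  rw [h1, powerSumExp_add _ _ (by simp) (by simp),
    Finset.Nat.sum_antidiagonal_eq_sum_range_succ_mk, Finset.sum_range]
  refine Finset.sum_congr rfl fun s _ => ?_
  rw [powerSumExp_one_sub_pow_mul_pow, ← h2, ← qone_eq_powerSumExp, Polynomial.CAlgHom_apply,
    Polynomial.C_mul]
  split_ifs <;> simp

theorem vandermonde_eq (N : ℕ) :
    vandermonde N = ∏ i : Fin N, ∏ j : Fin N, if i < j then X i - X j else 1 := by
  rw [vandermonde, Finset.prod_filter, ← Finset.univ_product_univ, Finset.prod_product]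

theorem finSuccEquiv_vandermonde (M : ℕ) :
    finSuccEquiv K M (vandermonde (M + 1)) =
      (∏ j : Fin M, (Polynomial.X - Polynomial.C (X j))) * Polynomial.C (vandermonde M) := by
  rw [vandermonde_eq, vandermonde_eq, Fin.prod_univ_succ, map_mul]
  congr 1
  · simp [Fin.prod_univ_succ, map_prod, finSuccEquiv_X_zero, finSuccEquiv_X_succ]
  · simp only [Fin.prod_univ_succ, map_prod, Fin.not_lt_zero, if_false, one_mul,
      Fin.succ_lt_succ_iff]
    refine Finset.prod_congr rfl fun i _ => Finset.prod_congr rfl fun j _ => ?_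
    split_ifs <;> simp [finSuccEquiv_X_succ]

theorem coeff_X_pow_mul_prod_X_sub_C (M k s : ℕ) :
    (Polynomial.X ^ s * ∏ j : Fin M, (Polynomial.X - Polynomial.C (X j : MvPolynomial (Fin M) K))
      ).coeff (k + M) = if k ≤ s then (-1) ^ (s - k) * esymm (Fin M) K (s - k) else 0 := by
  set u : Multiset (MvPolynomial (Fin M) K) := Finset.univ.val.map X with hu
  have hcard : u.card = M := by simp [hu]
  have hprod : ∏ j : Fin M, (Polynomial.X - Polynomial.C (X j : MvPolynomial (Fin M) K)) =
      (u.map fun x => Polynomial.X - Polynomial.C x).prod := by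
    rw [hu, Multiset.map_map]
    rfl
  rw [hprod, Polynomial.coeff_X_pow_mul', esymm_eq_multiset_esymm, ← hu]
  by_cases hs : s ≤ k + M
  · rw [if_pos hs]
    by_cases hks : k ≤ s
    · rw [if_pos hks, Multiset.prod_X_sub_C_coeff _ (by omega), hcard]
      have : M - (k + M - s) = s - k := by omega
      rw [this]
    · rw [if_neg hks]
      refine Polynomial.coeff_eq_zero_of_natDegree_lt ?_
      rw [Polynomial.natDegree_multiset_prod_X_sub_C_eq_card]
      omega
  · rw [if_neg hs, if_pos (by omega), Multiset.esymm, Multiset.powersetCard_eq_empty _ (by omega)]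
    simp

theorem hallPair_succ (M : ℕ) (f : MvPolynomial (Fin (M + 1)) K) (lamF : Fin (M + 1) → ℕ) :
    hallPair (M + 1) f lamF = hallPair M ((finSuccEquiv K M f *
      ∏ j : Fin M, (Polynomial.X - Polynomial.C (X j))).coeff (lamF 0 + M))
        (fun i => lamF i.succ) := by
  have h : (Finsupp.equivFunOnFinite.symm fun i : Fin (M + 1) => lamF i + (M + 1 - 1 - (i : ℕ))) =
      Finsupp.cons (lamF 0 + M)
        (Finsupp.equivFunOnFinite.symm fun i : Fin M => lamF i.succ + (M - 1 - (i : ℕ))) := by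
    ext i
    refine Fin.cases ?_ (fun i => ?_) i
    · simp
    · simp
      omega
  rw [hallPair, hallPair, h, ← finSuccEquiv_coeff_coeff, map_mul, finSuccEquiv_vandermonde,
    ← mul_assoc, Polynomial.coeff_mul_C]

theorem hallPair_sum {ι : Type*} (N : ℕ) (s : Finset ι) (f : ι → MvPolynomial (Fin N) K)
    (lamF : Fin N → ℕ) : hallPair N (∑ i ∈ s, f i) lamF = ∑ i ∈ s, hallPair N (f i) lamF := by
  simp only [hallPair, Finset.sum_mul, coeff_sum]

theorem hallPair_C_mul (N : ℕ) (c : K) (f : MvPolynomial (Fin N) K) (lamF : Fin N → ℕ) :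
    hallPair N (C c * f) lamF = c * hallPair N f lamF := by
  rw [hallPair, mul_assoc, coeff_C_mul, hallPair]

/-- Setting the last variable to zero. -/
def killLast (M : ℕ) : MvPolynomial (Fin (M + 1)) K →ₐ[K] MvPolynomial (Fin M) K :=
  killCompl (Fin.castSucc_injective M)

theorem killLast_X_castSucc (M : ℕ) (i : Fin M) : killLast M (X i.castSucc) = X i := by
  simpa [killLast] using killCompl_rename_app (R := K) (Fin.castSucc_injective M) (X i)

theorem killLast_X_last (M : ℕ) : killLast M (X (Fin.last M)) = 0 := by
  simp [killLast, killCompl]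

theorem killLast_qone (M : ℕ) (t : K) (r : ℕ) : killLast M (qone (M + 1) t r) = qone M t r := by
  rw [qone_eq_powerSumExp, map_powerSumExp, qone_eq_powerSumExp]
  congr 1
  ext1 j
  rcases Nat.eq_zero_or_pos j with rfl | hj
  · simp
  · rw [map_mul, algHom_C, psum, psum, Fin.sum_univ_castSucc]
    simp [killLast_X_castSucc, killLast_X_last, hj.ne']

theorem killLast_esymm (M r : ℕ) : killLast M (esymm (Fin (M + 1)) K r) = esymm (Fin M) K r := by
  have h : killLast M = aeval (fun i => killLast M (X i)) := (aeval_unique _)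
  rw [h, aeval_esymm_eq_multiset_esymm, esymm_eq_multiset_esymm]
  have hu : (Finset.univ : Finset (Fin (M + 1))).val.map (fun i => killLast M (X i)) =
      0 ::ₘ (Finset.univ : Finset (Fin M)).val.map X := by
    rw [Fin.univ_castSuccEmb]
    simp [killLast_X_last, killLast_X_castSucc, Function.comp_def]
  rw [hu]
  cases r with
  | zero => simp [Multiset.esymm]
  | succ r => simp [-Fin.univ_val_map, Multiset.esymm, Multiset.powersetCard_cons]

theorem killLast_vandermonde (M : ℕ) :
    killLast M (vandermonde (M + 1)) = vandermonde M * monomial (Finsupp.equivFunOnFinite.symm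
      fun _ => 1) 1 := by
  have hm : (monomial (Finsupp.equivFunOnFinite.symm fun _ : Fin M => 1) (1 : K)) =
      ∏ i : Fin M, X i := by
    rw [monomial_eq, Finsupp.prod_fintype _ _ (by simp)]
    simp
  rw [hm, vandermonde_eq, vandermonde_eq, Fin.prod_univ_castSucc, map_mul]
  have hl : ∀ j : Fin (M + 1), ¬ Fin.last M < j := fun j => not_lt.2 (Fin.le_last j)
  simp only [hl, if_false, Finset.prod_const_one, map_one, mul_one, map_prod,
    Fin.prod_univ_castSucc, Fin.castSucc_lt_last, if_true, Fin.castSucc_lt_castSucc_iff, map_mul,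
    map_sub, killLast_X_castSucc, killLast_X_last, sub_zero, Finset.prod_mul_distrib]
  congr 1
  refine Finset.prod_congr rfl fun i _ => Finset.prod_congr rfl fun j _ => ?_
  split_ifs <;> simp [killLast_X_castSucc]

theorem hallPair_killLast (M : ℕ) (f : MvPolynomial (Fin (M + 1)) K) (lamF : Fin (M + 1) → ℕ)
    (h0 : lamF (Fin.last M) = 0) :
    hallPair (M + 1) f lamF = hallPair M (killLast M f) (fun i => lamF i.castSucc) := by
  have h : (Finsupp.equivFunOnFinite.symm fun i : Fin (M + 1) => lamF i + (M + 1 - 1 - (i : ℕ))) =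
      Finsupp.mapDomain Fin.castSucc
        ((Finsupp.equivFunOnFinite.symm fun i : Fin M => lamF i.castSucc + (M - 1 - (i : ℕ))) +
          Finsupp.equivFunOnFinite.symm fun _ => 1) := by
    ext i
    refine Fin.lastCases ?_ (fun i => ?_) i
    · rw [Finsupp.mapDomain_of_notMem_range _ _ (by simp)]
      simp [h0]
    · rw [Finsupp.mapDomain_apply (Fin.castSucc_injective M)]
      simp
      omega
  rw [hallPair, hallPair, h, ← coeff_killCompl (Fin.castSucc_injective M)]
  change coeff _ (killLast M _) = _
  rw [map_mul, killLast_vandermonde, ← mul_assoc, coeff_mul_monomial, mul_one]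

theorem hallPair_prod_qone (M L : ℕ) (t : K) (mu : Fin L → ℕ) (lamF : Fin (M + 1) → ℕ) :
    hallPair (M + 1) (∏ i, qone (M + 1) t (mu i)) lamF =
      ∑ τ : (∀ i : Fin L, Fin (mu i + 1)), if lamF 0 ≤ ∑ i, (τ i : ℕ) then
        (1 - t) ^ (Finset.univ.filter fun i => (τ i : ℕ) ≠ 0).card *
          (-1 : K) ^ ((∑ i, (τ i : ℕ)) - lamF 0) *
          hallPair M ((∏ i, qone M t (mu i - τ i)) * esymm (Fin M) K ((∑ i, (τ i : ℕ)) - lamF 0))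
            (fun i => lamF i.succ)
      else 0 := by
  rw [hallPair_succ, map_prod]
  simp only [finSuccEquiv_qone]
  rw [Fintype.prod_sum, Finset.sum_mul, Polynomial.finsetSum_coeff, hallPair_sum]
  refine Finset.sum_congr rfl fun τ _ => ?_
  rw [Finset.prod_mul_distrib, Finset.prod_pow_eq_pow_sum, ← map_prod, mul_assoc,
    Polynomial.coeff_C_mul, coeff_X_pow_mul_prod_X_sub_C, Finset.prod_mul_distrib, ← map_prod,
    mul_assoc, hallPair_C_mul]
  have hp : ∏ i, (if (τ i : ℕ) = 0 then 1 else 1 - t) =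
      (1 - t) ^ (Finset.univ.filter fun i => (τ i : ℕ) ≠ 0).card := by
    rw [Finset.prod_ite]
    simp
  rw [hp]
  split_ifs
  · have : (∏ i, qone M t (mu i - τ i)) * ((-1) ^ ((∑ i, (τ i : ℕ)) - lamF 0) *
        esymm (Fin M) K ((∑ i, (τ i : ℕ)) - lamF 0)) =
        C ((-1 : K) ^ ((∑ i, (τ i : ℕ)) - lamF 0)) * ((∏ i, qone M t (mu i - τ i)) *
          esymm (Fin M) K ((∑ i, (τ i : ℕ)) - lamF 0)) := by
      simp only [map_pow, map_neg, map_one]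
      ring
    rw [this, hallPair_C_mul, mul_assoc]
  · simp [hallPair]

theorem qMulti_eq_prod_descSort (N : ℕ) (t : K) (s : Multiset ℕ) :
    qMulti N t s = ∏ i : Fin (descSort s).length, qone N t ((descSort s).get i) := by
  have h : ((descSort s : List ℕ) : Multiset ℕ) = s := by
    rw [descSort, Multiset.coe_reverse, Multiset.sort_eq]
  conv_lhs => rw [qMulti, ← h, Multiset.map_coe, Multiset.prod_coe]
  simp [← List.prod_ofFn, List.ofFn_getElem_eq_map]

end HallPairing

theorem dual_MN_inner_product_form (m n k N : ℕ)
    (mu : Nat.Partition m) (nu : Nat.Partition n)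
    (hk : (descSort nu.parts).getD 0 0 ≤ k)
    (hN1 : m ≤ N) (hN2 : (descSort nu.parts).length + 1 ≤ N) :
    hallPair N (qMulti N (RatFunc.X : K) mu.parts)
        (fun i : Fin N => if (i : ℕ) = 0 then k else (descSort nu.parts).getD ((i : ℕ) - 1) 0)
      = ∑ τ : (∀ i : Fin (descSort mu.parts).length, Fin ((descSort mu.parts).get i + 1)),
          if k ≤ ∑ i, ((τ i : ℕ)) then
            (1 - (RatFunc.X : K)) ^ (Finset.univ.filter fun i => ((τ i : ℕ)) ≠ 0).card
              * (-1 : K) ^ ((∑ i, ((τ i : ℕ))) - k)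
              * hallPair N
                  ((∏ i ∈ Finset.univ.filter (fun i => ((τ i : ℕ)) < (descSort mu.parts).get i),
                      qone N (RatFunc.X : K) ((descSort mu.parts).get i - (τ i : ℕ)))
                    * esymm (Fin N) K ((∑ i, ((τ i : ℕ))) - k))
                  (fun i : Fin N => (descSort nu.parts).getD (i : ℕ) 0)
          else 0 := by
  obtain ⟨M, rfl⟩ : ∃ M, N = M + 1 := ⟨N - 1, by omega⟩
  rw [qMulti_eq_prod_descSort, hallPair_prod_qone]
  refine Finset.sum_congr rfl fun τ _ => ?_
  have hlast : (descSort nu.parts).getD M 0 = 0 :=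
    List.getD_eq_default _ _ (by omega)
  have hprod : ∏ i ∈ Finset.univ.filter (fun i => ((τ i : ℕ)) < (descSort mu.parts).get i),
      qone (M + 1) (RatFunc.X : K) ((descSort mu.parts).get i - (τ i : ℕ)) =
      ∏ i, qone (M + 1) (RatFunc.X : K) ((descSort mu.parts).get i - (τ i : ℕ)) := by
    rw [Finset.prod_filter]
    refine Finset.prod_congr rfl fun i _ => ?_
    split_ifs with h
    · rfl
    · rw [Nat.sub_eq_zero_of_le (not_lt.1 h), qone_zero]
  rw [hprod, hallPair_killLast _ _ _ (by simpa using hlast), map_mul, map_prod, killLast_esymm]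
  simp [killLast_qone]

end
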